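/- For every K ≥ 2 and every γ ≥ 2, the per-round minimax value satisfies Val(γ) ≥ (1 − 1/K)/γ. -/

import Mathlib

open Finset

/-- The per-round minimax value
`Val(γ) = sup_{ŷ∈[0,1]^K} inf_{p∈Δ_K} sup_{f*∈[0,1]^K} max_{a*∈[K]}
   E_{a∼p}[f*_a − f*_{a*} − (γ/4)(ŷ_a − f*_a)²]`. -/
noncomputable def squareCBVal (K : ℕ) (γ : ℝ) : ℝ :=
  ⨆ yhat : {y : Fin K → ℝ // ∀ a, y a ∈ Set.Icc (0 : ℝ) 1},
    ⨅ p : {p : Fin K → ℝ // (∀ a, 0 ≤ p a) ∧ ∑ a, p a = 1},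
      ⨆ fstar : {f : Fin K → ℝ // ∀ a, f a ∈ Set.Icc (0 : ℝ) 1},
        ⨆ astar : Fin K,
          ∑ a : Fin K, p.1 a *
            (fstar.1 a - fstar.1 astar - (γ / 4) * (yhat.1 a - fstar.1 a) ^ 2)

/-- Proposition `minimax_lb`: for every `K ≥ 2` and `γ ≥ 2`,
`Val(γ) ≥ (1 − 1/K)/γ`. -/
theorem squareCB_minimax_lower (K : ℕ) (hK : 2 ≤ K) (γ : ℝ) (hγ : 2 ≤ γ) :
    (1 - 1 / (K : ℝ)) / γ ≤ squareCBVal K γ := by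
  have hK0 : (0:ℝ) < K := by exact_mod_cast (by omega : 0 < K)
  have : Nonempty (Fin K) := ⟨⟨0, by omega⟩⟩
  have hγ0 : 0 < γ := by linarith
  -- every payoff is at most one
  have hub : ∀ (y : {y : Fin K → ℝ // ∀ a, y a ∈ Set.Icc (0 : ℝ) 1})
      (p : {p : Fin K → ℝ // (∀ a, 0 ≤ p a) ∧ ∑ a, p a = 1})
      (f : {f : Fin K → ℝ // ∀ a, f a ∈ Set.Icc (0 : ℝ) 1}) (s : Fin K),
      ∑ a : Fin K, p.1 a * (f.1 a - f.1 s - (γ / 4) * (y.1 a - f.1 a) ^ 2) ≤ 1 := by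
    intro y p f s
    calc _ ≤ ∑ a : Fin K, p.1 a := by
          apply Finset.sum_le_sum
          intro a _
          have h1 := (f.2 a).2
          have h2 := (f.2 s).1
          have h3 : 0 ≤ (γ / 4) * (y.1 a - f.1 a) ^ 2 := by positivity
          exact mul_le_of_le_one_right (p.2.1 a) (by linarith)
      _ = 1 := p.2.2
  have hsup1 : ∀ (y : {y : Fin K → ℝ // ∀ a, y a ∈ Set.Icc (0 : ℝ) 1})
      (p : {p : Fin K → ℝ // (∀ a, 0 ≤ p a) ∧ ∑ a, p a = 1})
      (f : {f : Fin K → ℝ // ∀ a, f a ∈ Set.Icc (0 : ℝ) 1}),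
      (⨆ s : Fin K, ∑ a : Fin K, p.1 a *
        (f.1 a - f.1 s - (γ / 4) * (y.1 a - f.1 a) ^ 2)) ≤ 1 :=
    fun y p f => ciSup_le (hub y p f)
  have : Nonempty {f : Fin K → ℝ // ∀ a, f a ∈ Set.Icc (0 : ℝ) 1} :=
    ⟨⟨fun _ => 0, fun _ => by simp⟩⟩
  let pu : {p : Fin K → ℝ // (∀ a, 0 ≤ p a) ∧ ∑ a, p a = 1} :=
    ⟨fun _ => 1 / (K:ℝ), fun _ => by positivity, by
      simp [hK0.ne']⟩
  have : Nonempty {p : Fin K → ℝ // (∀ a, 0 ≤ p a) ∧ ∑ a, p a = 1} := ⟨pu⟩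
  have hle : ∀ (y : {y : Fin K → ℝ // ∀ a, y a ∈ Set.Icc (0 : ℝ) 1})
      (p : {p : Fin K → ℝ // (∀ a, 0 ≤ p a) ∧ ∑ a, p a = 1})
      (f : {f : Fin K → ℝ // ∀ a, f a ∈ Set.Icc (0 : ℝ) 1}) (s : Fin K),
      ∑ a : Fin K, p.1 a * (f.1 a - f.1 s - (γ / 4) * (y.1 a - f.1 a) ^ 2) ≤
      ⨆ f : {f : Fin K → ℝ // ∀ a, f a ∈ Set.Icc (0 : ℝ) 1},
        ⨆ s : Fin K, ∑ a : Fin K, p.1 a *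
          (f.1 a - f.1 s - (γ / 4) * (y.1 a - f.1 a) ^ 2) := by
    intro y p f s
    refine le_trans ?_ (le_ciSup (f := fun f : {f : Fin K → ℝ // ∀ a, f a ∈ Set.Icc (0 : ℝ) 1} =>
        ⨆ s : Fin K, ∑ a : Fin K, p.1 a *
          (f.1 a - f.1 s - (γ / 4) * (y.1 a - f.1 a) ^ 2)) ⟨1, ?_⟩ f)
    · exact le_ciSup (f := fun s : Fin K => ∑ a : Fin K, p.1 a *
          (f.1 a - f.1 s - (γ / 4) * (y.1 a - f.1 a) ^ 2)) (Set.finite_range _).bddAbove s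
    · rintro _ ⟨f, rfl⟩
      exact hsup1 y p f
  let y0 : {y : Fin K → ℝ // ∀ a, y a ∈ Set.Icc (0 : ℝ) 1} := ⟨fun _ => 0, fun _ => by simp⟩
  unfold squareCBVal
  refine le_ciSup_of_le ⟨1, ?_⟩ y0 ?_
  · rintro _ ⟨y, rfl⟩
    refine ciInf_le_of_le ⟨-1, ?_⟩ pu (ciSup_le (hsup1 y pu))
    rintro _ ⟨p, rfl⟩
    refine le_trans ?_ (hle y p y (Classical.arbitrary _))
    calc (-1:ℝ) = ∑ a : Fin K, -p.1 a := by rw [Finset.sum_neg_distrib, p.2.2]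
      _ ≤ _ := by
        apply Finset.sum_le_sum
        intro a _
        have h1 := (y.2 a).1
        have h2 := (y.2 (Classical.arbitrary (Fin K))).2
        have h3 := p.2.1 a
        rw [sub_self]
        nlinarith
  · refine le_ciInf fun p => ?_
    obtain ⟨s, hs⟩ : ∃ s, p.1 s ≤ 1 / (K:ℝ) := by
      by_contra! h
      have := Finset.sum_lt_sum_of_nonempty (s := (Finset.univ : Finset (Fin K)))
        Finset.univ_nonempty (fun a _ => h a)
      rw [p.2.2] at this
      simp [hK0.ne'] at this
    have h2γ : 2 / γ ≤ 1 := by rw [div_le_one hγ0]; exact hγ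
    have h2γ0 : 0 ≤ 2 / γ := by positivity
    refine le_trans ?_ (hle y0 p ⟨fun a => if a = s then 0 else 2 / γ, fun a => by
      dsimp only
      split_ifs
      · simp
      · exact ⟨h2γ0, h2γ⟩⟩ s)
    have hterm : ∀ a, p.1 a * ((if a = s then 0 else 2 / γ) - 0
        - (γ / 4) * (0 - (if a = s then 0 else 2 / γ)) ^ 2)
        = p.1 a * (1 / γ) - (if a = s then p.1 a * (1 / γ) else 0) := by
      intro a
      split_ifs
      · simp
      · field_simp
        ring
    simp only [y0, if_true]
    rw [Finset.sum_congr rfl (fun a _ => hterm a), Finset.sum_sub_distrib, ← Finset.sum_mul,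
      p.2.2, Finset.sum_ite_eq' Finset.univ s]
    simp only [Finset.mem_univ, if_true]
    rw [← sub_mul, mul_one_div]
    gcongr
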